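/- Let T be a tree with vertex set {1,...,n}, edge set {e_1,...,e_{n-1}}, and nonzero real edge weights w_1,...,w_{n-1}, and suppose T has no vertex of degree 2. Let Δ be the squared distance matrix of T. Then det Δ = (-1)^{n-1} (4^{n-2}/2) (∏_{i=1}^n τ_i) (∏_{i=1}^{n-1} w_i²) (Σ_{i=1}^n δ̂_i²/τ_i), where δ_i is the degree of vertex i, τ_i = 2 - δ_i, and δ̂_i is the weighted degree of vertex i. -/

import Mathlib

open Finset Matrix

noncomputable section

/-- The degree of vertex `v` in the graph `T`. -/
def degr {n : ℕ} (T : SimpleGraph (Fin n)) (v : Fin n) : ℕ := (T.neighborSet v).ncard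

/-- The weighted distance between `u` and `v`: the sum of the weights of the edges on
the unique `uv`-path in the tree `T` (edge `e i` goes from `(E i).1` to `(E i).2` and
has weight `w i`). -/
def wdist {n : ℕ} (T : SimpleGraph (Fin n)) (hc : T.Connected)
    (E : Fin (n-1) → Fin n × Fin n) (w : Fin (n-1) → ℝ) (u v : Fin n) : ℝ :=
  (((Nonempty.some (hc.preconnected u v)).toPath : T.Walk u v).edges.map
    (fun s => ∑ i : Fin (n-1), if s = s((E i).1, (E i).2) then w i else 0)).sum

/-- The weighted distance matrix. -/
def distMat {n : ℕ} (T : SimpleGraph (Fin n)) (hc : T.Connected)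
    (E : Fin (n-1) → Fin n × Fin n) (w : Fin (n-1) → ℝ) : Matrix (Fin n) (Fin n) ℝ :=
  Matrix.of fun u v => wdist T hc E w u v

/-- The squared distance matrix. -/
def sqDistMat {n : ℕ} (T : SimpleGraph (Fin n)) (hc : T.Connected)
    (E : Fin (n-1) → Fin n × Fin n) (w : Fin (n-1) → ℝ) : Matrix (Fin n) (Fin n) ℝ :=
  Matrix.of fun u v => (wdist T hc E w u v) ^ 2

/-- The weighted degree of vertex `v`: the sum of the weights of the edges incident to `v`. -/
def wdeg {n : ℕ} (E : Fin (n-1) → Fin n × Fin n) (w : Fin (n-1) → ℝ) (v : Fin n) : ℝ :=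
  ∑ k ∈ univ.filter (fun k => (E k).1 = v ∨ (E k).2 = v), w k

/-- The weighted Laplacian matrix: for `i ≠ j` the `(i,j)`-entry is `-1/w k` if `i` and `j`
are joined by the edge `e k` and `0` otherwise; diagonal entries make all row sums zero. -/
def lap {n : ℕ} (E : Fin (n-1) → Fin n × Fin n) (w : Fin (n-1) → ℝ) :
    Matrix (Fin n) (Fin n) ℝ :=
  Matrix.of fun i j =>
    if i = j then ∑ k ∈ univ.filter (fun k => (E k).1 = i ∨ (E k).2 = i), (w k)⁻¹
    else -∑ k ∈ univ.filter (fun k => E k = (i, j) ∨ E k = (j, i)), (w k)⁻¹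

/-- The oriented vertex-edge incidence matrix. -/
def incMat {n : ℕ} (E : Fin (n-1) → Fin n × Fin n) : Matrix (Fin n) (Fin (n-1)) ℝ :=
  Matrix.of fun v e => if (E e).1 = v then 1 else if (E e).2 = v then -1 else 0

/-- The edge orientation matrix: entry `(i,j)` is `1` if `e i` and `e j` are similarly
oriented (`d((E i).1, (E j).1) = d((E i).2, (E j).2)` for the unweighted distance) and
`-1` otherwise. -/
def orientMat {n : ℕ} (T : SimpleGraph (Fin n)) (E : Fin (n-1) → Fin n × Fin n) :
    Matrix (Fin (n-1)) (Fin (n-1)) ℝ :=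
  Matrix.of fun i j => if T.dist (E i).1 (E j).1 = T.dist (E i).2 (E j).2 then 1 else -1

/-- vertex-edge signed incidence -/
def qI {V ι : Type*} [DecidableEq V] (a b : ι → V) (v : V) (e : ι) : ℝ :=
  (if a e = v then 1 else 0) - (if b e = v then 1 else 0)

section absl
set_option linter.unusedSectionVars false
variable {V ι : Type*} [Fintype V] [DecidableEq V] [Fintype ι] [DecidableEq ι]

theorem sum_qI (a b : ι → V) (x : V → ℝ) (e : ι) :
    ∑ v, qI a b v e * x v = x (a e) - x (b e) := by
  simp [qI, sub_mul, Finset.sum_sub_distrib]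

/-- Data package for the abstract computation. -/
structure TD (a b : ι → V) (S : ι → V → ℝ) (τ : V → ℝ) : Prop where
  sq : ∀ e v, S e v * S e v = 1
  Sa : ∀ e, S e (a e) = 1
  Sb : ∀ e, S e (b e) = -1
  ne : ∀ e f, e ≠ f → S e (a f) = S e (b f)
  conn : ∀ x : V → ℝ, (∀ e, x (a e) = x (b e)) → ∀ u v, x u = x v
  deg : ∀ v, τ v = 2 - ∑ e, ((if a e = v then 1 else 0) + (if b e = v then 1 else 0))

/-- edge orientation matrix -/
def hM (a : ι → V) (S : ι → V → ℝ) (e f : ι) : ℝ :=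
  if e = f then 1 else - (S e (a f) * S f (a e))

variable {a b : ι → V} {S : ι → V → ℝ} {τ : V → ℝ}

theorem TD.ab (h : TD a b S τ) (e : ι) : a e ≠ b e := by
  intro hh
  have h1 := h.Sa e
  have h2 := h.Sb e
  rw [hh] at h1
  linarith

theorem TD.SQ (h : TD a b S τ) (e f : ι) :
    S e (a f) - S e (b f) = if e = f then 2 else 0 := by
  split_ifs with hh
  · subst hh; rw [h.Sa, h.Sb]; norm_num
  · rw [h.ne e f hh]; ring

theorem TD.QS (h : TD a b S τ) (u v : V) :
    ∑ f, qI a b u f * S f v = (if u = v then 2 else 0) - τ u := by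
  have key := h.conn (fun v => ∑ f, qI a b u f * S f v - (if u = v then 2 else 0)) (by
    intro e
    have : ∑ f, qI a b u f * S f (a e) - ∑ f, qI a b u f * S f (b e) = 2 * qI a b u e := by
      rw [← Finset.sum_sub_distrib]
      simp_rw [← mul_sub, h.SQ]
      simp [mul_comm]
    have h3 : 2 * qI a b u e = (if u = a e then 2 else 0) - (if u = b e then 2 else 0) := by
      unfold qI
      simp only [eq_comm (a := u)]
      split_ifs <;> norm_num
    linarith) v u
  have huu : ∑ f, qI a b u f * S f u = 2 - τ u := by
    rw [h.deg u, sub_sub_cancel]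
    refine Finset.sum_congr rfl fun f _ => ?_
    have hab := h.ab f
    unfold qI
    by_cases h1 : a f = u
    · have h2 : b f ≠ u := fun hh => hab (h1.trans hh.symm)
      have := h.Sa f
      rw [h1] at this
      simp [h1, h2, this]
    · by_cases h2 : b f = u
      · have := h.Sb f
        rw [h2] at this
        simp [h1, h2, this]
      · simp [h1, h2]
  simp only [if_true] at key
  rw [huu] at key
  linarith

theorem TD.sumτ (h : TD a b S τ) (hcard : Fintype.card V = Fintype.card ι + 1) :
    ∑ v, τ v = 2 := by
  simp_rw [h.deg]
  rw [Finset.sum_sub_distrib, Finset.sum_comm]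
  simp [Finset.sum_add_distrib, hcard]
  ring

theorem TD.HQ (h : TD a b S τ) (e : ι) (v : V) :
    ∑ f, qI a b v f * hM a S e f = S e v * τ v := by
  have h1 : ∀ f, qI a b v f * hM a S e f =
      - S e v * (qI a b v f * S f (a e)) +
        if e = f then qI a b v f * (1 + S e v) else 0 := by
    intro f
    unfold hM
    split_ifs with hef
    · subst hef; rw [h.Sa]; ring
    · have := h.ne e f hef
      unfold qI
      by_cases h1 : a f = v
      · subst h1; ring
      · by_cases h2 : b f = v
        · subst h2; rw [this]; ring
        · simp [h1, h2]
  simp_rw [h1]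
  rw [Finset.sum_add_distrib, ← Finset.mul_sum, h.QS]
  simp only [Finset.sum_ite_eq, Finset.mem_univ, if_true]
  unfold qI
  have hab := h.ab e
  by_cases h1 : a e = v
  · have h2 : b e ≠ v := fun hh => hab (h1.trans hh.symm)
    have := h.Sa e
    rw [h1] at this
    simp [h1, h2, this]; ring
  · by_cases h2 : b e = v
    · have := h.Sb e
      rw [h2] at this
      have h1' : ¬ v = a e := fun hh => h1 hh.symm
      simp [h1, h1', h2, this]
    · have h1' : ¬ v = a e := fun hh => h1 hh.symm
      simp [h1, h1', h2]

theorem TD.HQx (h : TD a b S τ) (e : ι) (x : V → ℝ) :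
    ∑ f, hM a S e f * (x (a f) - x (b f)) = ∑ v, S e v * τ v * x v := by
  simp_rw [← h.HQ, ← sum_qI, Finset.mul_sum, Finset.sum_mul]
  rw [Finset.sum_comm]
  exact Finset.sum_congr rfl fun _ _ => Finset.sum_congr rfl fun _ _ => by ring

theorem TD.Sτ (h : TD a b S τ) (e : ι) : ∑ v, S e v * τ v = 0 := by
  have := h.HQx e (fun _ => 1)
  simpa using this.symm

theorem TD.SτS (h : TD a b S τ) (e f : ι) : ∑ v, S e v * τ v * S f v = 2 * hM a S e f := by
  rw [← h.HQx e (S f)]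
  simp_rw [h.SQ]
  simp [mul_comm]

theorem TD.Hsq (h : TD a b S τ) (e f : ι) : hM a S e f * hM a S e f = 1 := by
  unfold hM
  split_ifs
  · norm_num
  · linear_combination (S f (a e) * S f (a e)) * h.sq e (a f) + h.sq f (a e)

/-- distance -/
def dd (w : ι → ℝ) (S : ι → V → ℝ) (u v : V) : ℝ := ∑ e, w e * ((1 - S e u * S e v) / 2)

theorem TD.dsub (h : TD a b S τ) (w : ι → ℝ) (e : ι) (v : V) :
    dd w S (a e) v - dd w S (b e) v = - w e * S e v := by
  unfold dd
  rw [← Finset.sum_sub_distrib]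
  have : ∀ f, w f * ((1 - S f (a e) * S f v) / 2) - w f * ((1 - S f (b e) * S f v) / 2)
      = if f = e then - w e * S e v else 0 := by
    intro f
    have := h.SQ f e
    split_ifs at this ⊢ with hh
    · subst hh; linear_combination (-w f * S f v / 2) * this
    · linear_combination (-w f * S f v / 2) * this
  simp_rw [this]
  simp

theorem dd_comm (w : ι → ℝ) (S : ι → V → ℝ) (u v : V) : dd w S u v = dd w S v u := by
  unfold dd
  exact Finset.sum_congr rfl fun _ _ => by ring

theorem TD.dself (h : TD a b S τ) (w : ι → ℝ) (u : V) : dd w S u u = 0 := by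
  unfold dd
  exact Finset.sum_eq_zero fun e _ => by rw [h.sq]; ring

/-- Q^T Δ Q -/
theorem TD.QDQ (h : TD a b S τ) (w : ι → ℝ) (e f : ι) :
    (dd w S (a e) (a f) ^ 2 - dd w S (b e) (a f) ^ 2)
      - (dd w S (a e) (b f) ^ 2 - dd w S (b e) (b f) ^ 2)
      = w e * (-2 * hM a S e f) * w f := by
  have h1 := h.dsub w e (a f)
  have h2 := h.dsub w e (b f)
  have h3 := h.dsub w f (a e)
  have e1 : dd w S (b e) (a f) = dd w S (a e) (a f) + w e * S e (a f) := by linarith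
  have e2 : dd w S (b e) (b f) = dd w S (a e) (b f) + w e * S e (b f) := by linarith
  have s1 := h.sq e (a f)
  have s2 := h.sq e (b f)
  by_cases hef : e = f
  · subst hef
    have e0 := h.dself w (a e)
    have e3 := h.dself w (b e)
    have ea := h.Sa e
    have eb := h.Sb e
    rw [ea] at h1
    have h4 : dd w S (a e) (b e) = w e := by rw [dd_comm]; linarith
    have h5 : dd w S (b e) (a e) = w e := by linarith
    rw [e0, e3, h4, h5]
    simp [hM]; ring
  · have hn := h.ne e f hef
    rw [dd_comm w S (a f), dd_comm w S (b f)] at h3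
    have e3 : dd w S (a e) (a f) = dd w S (a e) (b f) - w f * S f (a e) := by linarith
    rw [e1, e2, ← hn, e3]
    simp only [hM, hef, if_false]
    ring

/-- weighted degree -/
def wd (a b : ι → V) (w : ι → ℝ) (v : V) : ℝ :=
  ∑ e, w e * ((if a e = v then 1 else 0) + (if b e = v then 1 else 0))

theorem sum_wd (a b : ι → V) (w : ι → ℝ) (x : V → ℝ) :
    ∑ v, x v * wd a b w v = ∑ f, w f * (x (a f) + x (b f)) := by
  unfold wd
  simp_rw [Finset.mul_sum]
  rw [Finset.sum_comm]
  refine Finset.sum_congr rfl fun f _ => ?_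
  have : ∀ v, x v * (w f * ((if a f = v then 1 else 0) + (if b f = v then 1 else 0)))
    = w f * ((if a f = v then x v else 0) + (if b f = v then x v else 0)) := by
    intro v; split_ifs <;> ring
  simp_rw [this]
  rw [← Finset.mul_sum, Finset.sum_add_distrib]
  simp

theorem TD.QDτ (h : TD a b S τ) (w : ι → ℝ) (e : ι) :
    ∑ v, (dd w S (a e) v ^ 2 - dd w S (b e) v ^ 2) * τ v
      = - w e * ∑ v, S e v * wd a b w v := by
  rw [sum_wd]
  have h1 : ∀ v, (dd w S (a e) v ^ 2 - dd w S (b e) v ^ 2) * τ v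
      = - w e * (∑ f, (w f * (S e v * τ v) -
          (w f * ((S f (a e) + S f (b e)) / 2)) * (S e v * τ v * S f v))) := by
    intro v
    have h2 : dd w S (a e) v + dd w S (b e) v
        = ∑ f, (w f - (w f * ((S f (a e) + S f (b e)) / 2)) * S f v) := by
      unfold dd
      rw [← Finset.sum_add_distrib]
      exact Finset.sum_congr rfl fun _ _ => by ring
    have h3 : (∑ f, (w f * (S e v * τ v) -
          (w f * ((S f (a e) + S f (b e)) / 2)) * (S e v * τ v * S f v)))
        = S e v * τ v * (dd w S (a e) v + dd w S (b e) v) := by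
      rw [h2, Finset.mul_sum]
      exact Finset.sum_congr rfl fun _ _ => by ring
    rw [h3]
    linear_combination (τ v * (dd w S (a e) v + dd w S (b e) v)) * h.dsub w e v
  simp_rw [h1]
  rw [← Finset.mul_sum, Finset.sum_comm]
  congr 1
  refine Finset.sum_congr rfl fun f _ => ?_
  rw [Finset.sum_sub_distrib, ← Finset.mul_sum, ← Finset.mul_sum, h.Sτ, h.SτS]
  by_cases hef : e = f
  · subst hef
    rw [h.Sa, h.Sb]; ring
  · rw [← h.ne f e (Ne.symm hef), ← h.ne e f hef]
    simp only [hM, hef, if_false]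
    linear_combination (2 * w f * S e (a f)) * h.sq f (a e)

theorem TD.τDτ (h : TD a b S τ) (hcard : Fintype.card V = Fintype.card ι + 1) (w : ι → ℝ) :
    ∑ u, ∑ v, τ u * dd w S u v ^ 2 * τ v = 2 * (∑ e, w e) ^ 2 := by
  have h1 : ∀ u v, τ u * dd w S u v ^ 2 * τ v = ∑ e, ∑ f, w e * w f / 4 *
      (τ u * τ v - (S e u * τ u) * (S e v * τ v) - (S f u * τ u) * (S f v * τ v)
        + (S e u * τ u * S f u) * (S e v * τ v * S f v)) := by
    intro u v
    unfold dd
    rw [pow_two, Finset.sum_mul_sum, Finset.mul_sum, Finset.sum_mul]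
    refine Finset.sum_congr rfl fun e _ => ?_
    rw [Finset.mul_sum, Finset.sum_mul]
    exact Finset.sum_congr rfl fun _ _ => by ring
  simp_rw [h1]
  have h2 : ∀ e f, ∑ u, ∑ v, w e * w f / 4 *
      (τ u * τ v - (S e u * τ u) * (S e v * τ v) - (S f u * τ u) * (S f v * τ v)
        + (S e u * τ u * S f u) * (S e v * τ v * S f v)) = w e * w f * 2 := by
    intro e f
    simp_rw [← Finset.mul_sum, Finset.sum_add_distrib, Finset.sum_sub_distrib,
      ← Finset.mul_sum, h.Sτ, h.SτS, h.sumτ hcard, ← Finset.sum_mul, h.sumτ hcard, h.SτS, h.Sτ]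
    linear_combination (w e * w f) * h.Hsq e f
  have h3 : ∀ F : V → V → ι → ι → ℝ, ∑ u, ∑ v, ∑ e, ∑ f, F u v e f
      = ∑ e, ∑ f, ∑ u, ∑ v, F u v e f := by
    intro F
    calc _ = ∑ u, ∑ e, ∑ v, ∑ f, F u v e f :=
          Finset.sum_congr rfl fun u _ => Finset.sum_comm
      _ = ∑ e, ∑ u, ∑ v, ∑ f, F u v e f := Finset.sum_comm
      _ = ∑ e, ∑ u, ∑ f, ∑ v, F u v e f :=
          Finset.sum_congr rfl fun e _ => Finset.sum_congr rfl fun u _ => Finset.sum_comm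
      _ = _ := Finset.sum_congr rfl fun e _ => Finset.sum_comm
  rw [h3]
  simp_rw [h2]
  rw [pow_two, Finset.sum_mul_sum, Finset.mul_sum]
  refine Finset.sum_congr rfl fun e _ => ?_
  rw [Finset.mul_sum]
  exact Finset.sum_congr rfl fun _ _ => by ring

end absl
section detpart
set_option linter.unusedSectionVars false
variable {V ι : Type*} [Fintype V] [DecidableEq V] [Fintype ι] [DecidableEq ι]
variable {a b : ι → V} {S : ι → V → ℝ} {τ : V → ℝ}

/-- the square matrix [Q | x] -/
def pM (a b : ι → V) (x : V → ℝ) : Matrix V (ι ⊕ Unit) ℝ :=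
  Matrix.of fun v j => Sum.elim (fun e => qI a b v e) (fun _ => x v) j

theorem mulP_inl {κ : Type*} (M : Matrix κ V ℝ) (x : V → ℝ) (k : κ) (e : ι) :
    (M * pM a b x) k (Sum.inl e) = M k (a e) - M k (b e) := by
  rw [← sum_qI a b (M k) e]
  simp [Matrix.mul_apply, pM, mul_comm]

theorem mulP_inr {κ : Type*} (M : Matrix κ V ℝ) (x : V → ℝ) (k : κ) (e : Unit) :
    (M * pM a b x) k (Sum.inr e) = ∑ v, M k v * x v := by
  simp [Matrix.mul_apply, pM]

theorem Pmul_inl {κ : Type*} (M : Matrix V κ ℝ) (x : V → ℝ) (k : κ) (e : ι) :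
    ((pM a b x)ᵀ * M) (Sum.inl e) k = M (a e) k - M (b e) k := by
  rw [← sum_qI a b (fun v => M v k) e]
  simp [Matrix.mul_apply, pM]

theorem Pmul_inr {κ : Type*} (M : Matrix V κ ℝ) (x : V → ℝ) (k : κ) (e : Unit) :
    ((pM a b x)ᵀ * M) (Sum.inr e) k = ∑ v, x v * M v k := by
  simp [Matrix.mul_apply, pM]

/-- determinant of congruence -/
theorem det_congr_P (σ : V ≃ ι ⊕ Unit) (x : V → ℝ) (M : Matrix V V ℝ) :
    ((pM a b x)ᵀ * M * pM a b x).det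
      = ((pM a b x).submatrix id σ).det ^ 2 * M.det := by
  have h : ((pM a b x)ᵀ * M * pM a b x).submatrix σ σ
      = ((pM a b x).submatrix id σ)ᵀ * M * ((pM a b x).submatrix id σ) := by
    ext i j
    simp [Matrix.mul_apply]
  rw [← Matrix.det_submatrix_equiv_self σ, h, Matrix.det_mul, Matrix.det_mul, Matrix.det_transpose]
  ring

theorem TD.detP (h : TD a b S τ) (σ : V ≃ ι ⊕ Unit)
    (hcard : Fintype.card V = Fintype.card ι + 1)
    (c : ι → V → ℤ) (hc : ∀ e v, S e v = 1 - 2 * (c e v : ℝ)) (r : V) :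
    ((pM a b (fun v => τ v / 2)).submatrix id σ).det ^ 2 = 1 := by
  set P : Matrix V V ℝ := (pM a b (fun v => τ v / 2)).submatrix id σ with hP
  set P0 : Matrix V V ℝ := (pM a b (fun v => if v = r then 1 else 0)).submatrix id σ with hP0
  let R : Matrix (ι ⊕ Unit) V ℝ := Matrix.of fun j v => Sum.elim (fun e => S e v / 2) (fun _ => 1) j
  have hRP : R * pM a b (fun v => τ v / 2) = 1 := by
    ext i j
    rcases i with e | i <;> rcases j with f | j
    · rw [mulP_inl]
      have := h.SQ e f
      simp only [R, Matrix.of_apply, Sum.elim_inl, Matrix.one_apply, Sum.inl.injEq]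
      split_ifs at this ⊢ <;> linarith
    · rw [mulP_inr]
      have := h.Sτ e
      simp only [R, Matrix.of_apply, Sum.elim_inl, Matrix.one_apply, reduceCtorEq, if_false]
      have h2 : ∀ v, S e v / 2 * (τ v / 2) = (S e v * τ v) / 4 := fun v => by ring
      simp_rw [h2]
      rw [← Finset.sum_div, this]; simp
    · rw [mulP_inl]; simp [R]
    · rw [mulP_inr]
      simp only [R, Matrix.of_apply, Sum.elim_inr, Matrix.one_apply, if_true, one_mul]
      rw [← Finset.sum_div, h.sumτ hcard]; norm_num
  have hRP0 : R * pM a b (fun v => if v = r then 1 else 0)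
      = Matrix.fromBlocks 1 (Matrix.of fun e _ => S e r / 2) 0 1 := by
    ext i j
    rcases i with e | i <;> rcases j with f | j
    · rw [mulP_inl]
      have := h.SQ e f
      simp only [R, Matrix.of_apply, Sum.elim_inl, Matrix.one_apply, Matrix.fromBlocks_apply₁₁]
      split_ifs at this ⊢ <;> linarith
    · rw [mulP_inr]
      simp [R]
    · rw [mulP_inl]; simp [R]
    · rw [mulP_inr]; simp [R]
  have e1 : (R.submatrix σ id).det * P.det = 1 := by
    rw [← Matrix.det_mul, hP, ← Matrix.submatrix_mul _ _ _ _ _ Function.bijective_id, hRP,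
      Matrix.det_submatrix_equiv_self, Matrix.det_one]
  have e2 : (R.submatrix σ id).det * P0.det = 1 := by
    rw [← Matrix.det_mul, hP0, ← Matrix.submatrix_mul _ _ _ _ _ Function.bijective_id, hRP0,
      Matrix.det_submatrix_equiv_self, Matrix.det_fromBlocks_zero₂₁]
    simp
  have e3 : P.det = P0.det := by
    have hne : (R.submatrix σ id).det ≠ 0 := left_ne_zero_of_mul_eq_one e1
    exact mul_left_cancel₀ hne (e1.trans e2.symm)
  -- integrality
  let Z0 : Matrix V (ι ⊕ Unit) ℤ := Matrix.of fun v j =>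
    Sum.elim (fun e => (if a e = v then 1 else 0) - (if b e = v then 1 else 0))
      (fun _ => if v = r then 1 else 0) j
  let ZR : Matrix (ι ⊕ Unit) V ℤ := Matrix.of fun j v =>
    Sum.elim (fun e => c e r - c e v) (fun _ => 1) j
  have hZ : Z0.map (Int.castRingHom ℝ) = pM a b (fun v => if v = r then 1 else 0) := by
    ext v j
    rcases j with e | j <;> simp [Z0, pM, qI]
  have hZR : (ZR.map (Int.castRingHom ℝ)) * pM a b (fun v => if v = r then 1 else 0) = 1 := by
    ext i j
    rcases i with e | i <;> rcases j with f | j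
    · rw [mulP_inl]
      have := h.SQ e f
      rw [hc, hc] at this
      simp only [ZR, Matrix.map_apply, Matrix.of_apply, Sum.elim_inl, Matrix.one_apply,
        Sum.inl.injEq]
      push_cast [eq_intCast]
      split_ifs at this ⊢ <;> linarith
    · rw [mulP_inr]
      simp [ZR]
    · rw [mulP_inl]; simp [ZR]
    · rw [mulP_inr]; simp [ZR]
  have hI : ZR * Z0 = 1 := by
    have h1 : (ZR * Z0).map (Int.castRingHom ℝ) = (1 : Matrix (ι ⊕ Unit) (ι ⊕ Unit) ℤ).map (Int.castRingHom ℝ) := by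
      rw [Matrix.map_mul, hZ, hZR]
      simp
    exact Matrix.map_injective (RingHom.injective_int (Int.castRingHom ℝ)) h1
  have e4 : (ZR.submatrix σ id).det * (Z0.submatrix id σ).det = 1 := by
    rw [← Matrix.det_mul, ← Matrix.submatrix_mul _ _ _ _ _ Function.bijective_id, hI,
      Matrix.det_submatrix_equiv_self, Matrix.det_one]
  have e5 : P0.det = ((Z0.submatrix id σ).det : ℝ) := by
    have := (Int.castRingHom ℝ).map_det (Z0.submatrix id σ)
    simp only [eq_intCast] at this
    rw [this, hP0, ← hZ]
    rfl
  have e6 : (Z0.submatrix id σ).det ^ 2 = 1 := by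
    rcases Int.isUnit_iff.mp (IsUnit.of_mul_eq_one_right _ e4) with h | h <;> rw [h] <;> norm_num
  rw [e3, e5]
  exact_mod_cast e6

theorem TD.detH (h : TD a b S τ) (σ : V ≃ ι ⊕ Unit)
    (hcard : Fintype.card V = Fintype.card ι + 1) (hτ : ∀ v, τ v ≠ 0)
    (c : ι → V → ℤ) (hc : ∀ e v, S e v = 1 - 2 * (c e v : ℝ)) (r : V) :
    (Matrix.of (hM a S)).det = 2 ^ (Fintype.card ι) / 2 * ∏ v, τ v := by
  have h1 := det_congr_P (a := a) (b := b) σ (fun v => τ v / 2) (Matrix.diagonal fun v => (τ v)⁻¹)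
  rw [h.detP σ hcard c hc r, one_mul, Matrix.det_diagonal] at h1
  let K : Matrix ι ι ℝ := Matrix.of fun e f =>
    ((if a e = a f then (τ (a f))⁻¹ else 0) - (if b e = a f then (τ (a f))⁻¹ else 0))
    - ((if a e = b f then (τ (b f))⁻¹ else 0) - (if b e = b f then (τ (b f))⁻¹ else 0))
  have hd : ∀ u v, Matrix.diagonal (fun v => (τ v)⁻¹) u v = if u = v then (τ v)⁻¹ else 0 := by
    intro u v
    rw [Matrix.diagonal_apply]
    split_ifs with huv
    · rw [huv]
    · rfl
  have h2 : (pM a b (fun v => τ v / 2))ᵀ * (Matrix.diagonal fun v => (τ v)⁻¹)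
      * pM a b (fun v => τ v / 2) = Matrix.fromBlocks K 0 0 (Matrix.of fun _ _ => 1 / 2) := by
    ext i j
    rcases i with e | i <;> rcases j with f | j
    · rw [mulP_inl, Pmul_inl, Pmul_inl]
      rw [hd, hd, hd, hd]
      rfl
    · rw [mulP_inr]
      simp_rw [Pmul_inl]
      simp [Matrix.diagonal_apply, sub_mul, Finset.sum_sub_distrib]
      field_simp [hτ (a e), hτ (b e)]
      simp
    · rw [mulP_inl, Pmul_inr, Pmul_inr]
      simp [Matrix.diagonal_apply]
      field_simp [hτ (a f), hτ (b f)]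
      simp
    · rw [mulP_inr]
      simp_rw [Pmul_inr]
      simp [Matrix.diagonal_apply]
      have h3 : ∀ v, τ v / 2 * (τ v)⁻¹ * (τ v / 2) = τ v / 4 := fun v => by
        have := hτ v
        field_simp; norm_num
      simp_rw [h3]
      rw [← Finset.sum_div, h.sumτ hcard]; norm_num
  rw [h2, Matrix.det_fromBlocks_zero₂₁] at h1
  have h4 : (Matrix.of (hM a S)) * K = (2 : ℝ) • (1 : Matrix ι ι ℝ) := by
    ext e f
    rw [Matrix.mul_apply]
    have h5 := h.HQx e (fun v => (if v = a f then (τ (a f))⁻¹ else 0)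
      - (if v = b f then (τ (b f))⁻¹ else 0))
    have h6 : ∀ g, K g f = (fun v => (if v = a f then (τ (a f))⁻¹ else 0)
      - (if v = b f then (τ (b f))⁻¹ else 0)) (a g) - (fun v => (if v = a f then (τ (a f))⁻¹ else 0)
      - (if v = b f then (τ (b f))⁻¹ else 0)) (b g) := by
      intro g
      simp only [K, Matrix.of_apply]; ring
    simp only [Matrix.of_apply, h6]
    rw [h5]
    simp only [mul_sub, Finset.sum_sub_distrib, mul_ite, mul_zero, Finset.sum_ite_eq',
      Finset.mem_univ, if_true]
    have := h.SQ e f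
    rw [mul_assoc, mul_assoc, mul_inv_cancel₀ (hτ _), mul_inv_cancel₀ (hτ _), mul_one, mul_one, this]
    simp [Matrix.one_apply]
  have h7 := congrArg Matrix.det h4
  rw [Matrix.det_mul, Matrix.det_smul, Matrix.det_one, mul_one] at h7
  have h8 : ∏ v, τ v ≠ 0 := Finset.prod_ne_zero_iff.mpr fun v _ => hτ v
  rw [Finset.prod_inv_distrib] at h1
  simp at h1
  have h9 : K.det * ∏ v, τ v = 2 := by
    field_simp at h1
    linarith
  linear_combination (-(Matrix.of (hM a S)).det / 2) * h9 + (∏ v, τ v) / 2 * h7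

theorem TD.main (h : TD a b S τ) (σ : V ≃ ι ⊕ Unit)
    (hcard : Fintype.card V = Fintype.card ι + 1) (hτ : ∀ v, τ v ≠ 0)
    (c : ι → V → ℤ) (hc : ∀ e v, S e v = 1 - 2 * (c e v : ℝ)) (r : V) (w : ι → ℝ) :
    (Matrix.of fun u v => dd w S u v ^ 2 : Matrix V V ℝ).det
      = (-2) ^ (Fintype.card ι) * (2 ^ (Fintype.card ι) / 2 * ∏ v, τ v) * (∏ e, w e ^ 2)
        * ((∑ v, wd a b w v ^ 2 / τ v) / 4) := by
  set Δ : Matrix V V ℝ := Matrix.of fun u v => dd w S u v ^ 2 with hΔ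
  have h1 := det_congr_P (a := a) (b := b) σ (fun v => τ v / 2) Δ
  rw [h.detP σ hcard c hc r, one_mul] at h1
  rw [← h1]
  let z : ι → ℝ := fun e => ∑ v, S e v * wd a b w v
  let y : ι → ℝ := fun e => wd a b w (a e) / τ (a e) - wd a b w (b e) / τ (b e)
  let M0 : Matrix (ι ⊕ Unit) (ι ⊕ Unit) ℝ := Matrix.fromBlocks ((-2 : ℝ) • Matrix.of (hM a S))
    (Matrix.of fun e _ => - z e / 2) (Matrix.of fun _ e => - z e / 2)
    (Matrix.of fun _ _ => (∑ e, w e) ^ 2 / 2)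
  let D : Matrix (ι ⊕ Unit) (ι ⊕ Unit) ℝ := Matrix.diagonal (Sum.elim w (fun _ => 1))
  have h2 : (pM a b (fun v => τ v / 2))ᵀ * Δ * pM a b (fun v => τ v / 2) = D * M0 * D := by
    ext i j
    simp only [D, Matrix.mul_diagonal, Matrix.diagonal_mul]
    rcases i with e | i <;> rcases j with f | j
    · rw [mulP_inl, Pmul_inl, Pmul_inl]
      exact h.QDQ w e f
    · rw [mulP_inr]
      simp_rw [Pmul_inl]
      have := h.QDτ w e
      simp only [hΔ, M0, Matrix.of_apply, Matrix.fromBlocks_apply₁₂, Sum.elim_inl, Sum.elim_inr, z]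
      simp_rw [← mul_div_assoc]
      rw [← Finset.sum_div, this]; ring
    · rw [mulP_inl, Pmul_inr, Pmul_inr, ← Finset.sum_sub_distrib]
      have := h.QDτ w f
      simp only [hΔ, M0, Matrix.of_apply, Matrix.fromBlocks_apply₂₁, Sum.elim_inl, Sum.elim_inr, z]
      have h3 : ∀ v, τ v / 2 * dd w S v (a f) ^ 2 - τ v / 2 * dd w S v (b f) ^ 2
        = (dd w S (a f) v ^ 2 - dd w S (b f) v ^ 2) * τ v / 2 := fun v => by
        rw [dd_comm w S v, dd_comm w S v]; ring
      simp_rw [h3]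
      rw [← Finset.sum_div, this]; ring
    · rw [mulP_inr]
      simp_rw [Pmul_inr]
      have := h.τDτ hcard w
      simp only [hΔ, M0, Matrix.of_apply, Matrix.fromBlocks_apply₂₂, Sum.elim_inr]
      have h3 : ∑ v, (∑ u, τ u / 2 * dd w S u v ^ 2) * (τ v / 2)
          = (∑ u, ∑ v, τ u * dd w S u v ^ 2 * τ v) / 4 := by
        rw [Finset.sum_comm, Finset.sum_div]
        refine Finset.sum_congr rfl fun v _ => ?_
        rw [Finset.sum_mul, Finset.sum_div]
        exact Finset.sum_congr rfl fun u _ => by ring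
      rw [h3, this]; ring
  have hHy : ∀ e, ∑ f, hM a S e f * y f = z e := by
    intro e
    have := h.HQx e (fun v => wd a b w v / τ v)
    simp only [y, z]
    rw [this]
    refine Finset.sum_congr rfl fun v _ => ?_
    have := hτ v
    field_simp
  have hsumwd : ∑ v, wd a b w v = 2 * ∑ e, w e := by
    have := sum_wd a b w (fun _ => 1)
    simp only [one_mul] at this
    rw [this, Finset.mul_sum]
    exact Finset.sum_congr rfl fun v _ => by ring
  have hzy : ∑ e, z e * y e = 2 * (∑ v, wd a b w v ^ 2 / τ v) - 4 * (∑ e, w e) ^ 2 := by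
    have q1 : ∀ e, z e * y e = ∑ u, ∑ v, (wd a b w u / τ u) * ((qI a b u e * S e v) * wd a b w v) := by
      intro e
      have := sum_qI a b (fun v => wd a b w v / τ v) e
      simp only [y, z]
      rw [← this, mul_comm, Finset.sum_mul]
      refine Finset.sum_congr rfl fun u _ => ?_
      rw [Finset.mul_sum]
      exact Finset.sum_congr rfl fun u _ => by ring
    simp_rw [q1]
    rw [Finset.sum_comm]
    have q2 : ∀ u, ∑ e, ∑ v, (wd a b w u / τ u) * ((qI a b u e * S e v) * wd a b w v)
        = 2 * (wd a b w u ^ 2 / τ u) - wd a b w u * (2 * ∑ e, w e) := by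
      intro u
      rw [Finset.sum_comm]
      simp_rw [← Finset.mul_sum, ← Finset.sum_mul, h.QS, sub_mul, Finset.sum_sub_distrib,
        ← Finset.mul_sum, hsumwd]
      simp
      have := hτ u
      field_simp
    simp_rw [q2]
    rw [Finset.sum_sub_distrib, ← Finset.mul_sum, ← Finset.sum_mul, hsumwd]
    ring
  have h5 : M0 * Matrix.fromBlocks 1 (Matrix.of fun e (_ : Unit) => - y e / 4) 0 1
      = Matrix.fromBlocks ((-2 : ℝ) • Matrix.of (hM a S)) 0 (Matrix.of fun _ e => - z e / 2)
        (Matrix.of fun _ _ => (∑ v, wd a b w v ^ 2 / τ v) / 4) := by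
    simp only [M0, Matrix.fromBlocks_multiply, Matrix.mul_one, Matrix.mul_zero, add_zero]
    congr 1
    · ext e i
      simp only [Matrix.add_apply, Matrix.mul_apply, Matrix.smul_apply, Matrix.of_apply,
        smul_eq_mul, Matrix.zero_apply]
      rw [← hHy e, neg_div, Finset.sum_div, ← Finset.sum_neg_distrib, ← Finset.sum_add_distrib]
      exact Finset.sum_eq_zero fun f _ => by ring
    · ext i j
      simp only [Matrix.add_apply, Matrix.mul_apply, Matrix.of_apply]
      have : ∀ e, - z e / 2 * (- y e / 4) = z e * y e / 8 := fun e => by ring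
      simp_rw [this]
      rw [← Finset.sum_div, hzy]; ring
  have h6 := congrArg Matrix.det h5
  rw [Matrix.det_mul, Matrix.det_fromBlocks_zero₂₁, Matrix.det_fromBlocks_zero₁₂,
    Matrix.det_smul, h.detH σ hcard hτ c hc r] at h6
  simp only [Matrix.det_one, mul_one, Matrix.det_unique, Matrix.of_apply, Matrix.one_apply_eq] at h6
  rw [h2, Matrix.det_mul, Matrix.det_mul, h6, Matrix.det_diagonal]
  simp only [Fintype.prod_sum_type, Sum.elim_inl, Sum.elim_inr, Finset.prod_const_one, mul_one,
    Finset.prod_pow]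
  ring

end detpart
section graphpart
open Classical in
/-- side indicator of the edge `s(p,q)` -/
def sideI {n : ℕ} (T : SimpleGraph (Fin n)) (E : Fin (n-1) → Fin n × Fin n)
    (e : Fin (n-1)) (v : Fin n) : ℤ :=
  if (T.deleteEdges {s((E e).1, (E e).2)}).Reachable (E e).1 v then 0 else 1

/-- side sign -/
def sideS {n : ℕ} (T : SimpleGraph (Fin n)) (E : Fin (n-1) → Fin n × Fin n)
    (e : Fin (n-1)) (v : Fin n) : ℝ := 1 - 2 * (sideI T E e v : ℝ)

theorem sideS_sq {n : ℕ} (T : SimpleGraph (Fin n)) (E : Fin (n-1) → Fin n × Fin n)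
    (e : Fin (n-1)) (v : Fin n) : sideS T E e v * sideS T E e v = 1 := by
  unfold sideS sideI
  split_ifs <;> norm_num

theorem sideS_adj {n : ℕ} (T : SimpleGraph (Fin n)) (E : Fin (n-1) → Fin n × Fin n)
    (e : Fin (n-1)) (u v : Fin n) (h : T.Adj u v) (hne : s(u, v) ≠ s((E e).1, (E e).2)) :
    sideS T E e u = sideS T E e v := by
  have hadj : (T.deleteEdges {s((E e).1, (E e).2)}).Adj u v := by
    rw [SimpleGraph.deleteEdges_adj]
    exact ⟨h, by simpa using hne⟩
  have : (T.deleteEdges {s((E e).1, (E e).2)}).Reachable (E e).1 u ↔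
      (T.deleteEdges {s((E e).1, (E e).2)}).Reachable (E e).1 v :=
    ⟨fun h => h.trans hadj.reachable, fun h => h.trans hadj.symm.reachable⟩
  have h2 : sideI T E e u = sideI T E e v := by
    unfold sideI
    by_cases hu : (T.deleteEdges {s((E e).1, (E e).2)}).Reachable (E e).1 u
    · rw [if_pos hu, if_pos (this.mp hu)]
    · rw [if_neg hu, if_neg fun h => hu (this.mpr h)]
  unfold sideS
  rw [h2]

theorem sideS_walk {n : ℕ} (T : SimpleGraph (Fin n)) (E : Fin (n-1) → Fin n × Fin n)
    (e : Fin (n-1)) {u v : Fin n} (p : T.Walk u v) (hp : s((E e).1, (E e).2) ∉ p.edges) :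
    sideS T E e u = sideS T E e v := by
  induction p with
  | nil => rfl
  | cons h p ih =>
    rw [SimpleGraph.Walk.edges_cons, List.mem_cons, not_or] at hp
    rw [sideS_adj T E e _ _ h (Ne.symm hp.1), ih hp.2]

theorem degr_eq {n : ℕ} (T : SimpleGraph (Fin n))
    (E : Fin (n - 1) → Fin n × Fin n)
    (hE : ∀ i, T.Adj (E i).1 (E i).2)
    (hinj : Function.Injective fun i => (s((E i).1, (E i).2) : Sym2 (Fin n)))
    (hsurj : ∀ e ∈ T.edgeSet, ∃ i, e = s((E i).1, (E i).2)) (v : Fin n) :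
    (degr T v : ℝ) = ∑ e, ((if (E e).1 = v then 1 else 0) + (if (E e).2 = v then 1 else 0)) := by
  classical
  have h1 : ∀ e, ((if (E e).1 = v then (1:ℝ) else 0) + (if (E e).2 = v then 1 else 0))
      = if ((E e).1 = v ∨ (E e).2 = v) then 1 else 0 := by
    intro e
    have := (hE e).ne
    by_cases h1 : (E e).1 = v <;> by_cases h2 : (E e).2 = v <;> simp [h1, h2]
    exact this (h1.trans h2.symm)
  simp_rw [h1]
  rw [Finset.sum_boole]
  have h2 : T.incidenceFinset v = (univ.filter fun e => (E e).1 = v ∨ (E e).2 = v).image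
      (fun i => (s((E i).1, (E i).2) : Sym2 (Fin n))) := by
    ext x
    rw [SimpleGraph.mem_incidenceFinset, Finset.mem_image]
    constructor
    · rintro ⟨hx, hv⟩
      obtain ⟨i, rfl⟩ := hsurj x hx
      refine ⟨i, ?_, rfl⟩
      rw [Sym2.mem_iff] at hv
      simp only [Finset.mem_filter, Finset.mem_univ, true_and]
      rcases hv with h | h
      · exact Or.inl h.symm
      · exact Or.inr h.symm
    · rintro ⟨i, hi, rfl⟩
      simp only [Finset.mem_filter, Finset.mem_univ, true_and] at hi
      refine ⟨hE i, ?_⟩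
      rw [Sym2.mem_iff]
      rcases hi with h | h
      · exact Or.inl h.symm
      · exact Or.inr h.symm
  have h3 : degr T v = T.degree v := by
    unfold degr
    rw [Set.ncard_eq_toFinset_card']
    rfl
  rw [h3, ← SimpleGraph.card_incidenceFinset_eq_degree, h2, Finset.card_image_of_injective _ hinj]

theorem wdeg_eq {n : ℕ} (T : SimpleGraph (Fin n))
    (E : Fin (n - 1) → Fin n × Fin n) (w : Fin (n - 1) → ℝ)
    (hE : ∀ i, T.Adj (E i).1 (E i).2) (v : Fin n) :
    wdeg E w v = wd (fun e => (E e).1) (fun e => (E e).2) w v := by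
  unfold wdeg wd
  rw [Finset.sum_filter]
  refine Finset.sum_congr rfl fun e _ => ?_
  have := (hE e).ne
  by_cases h1 : (E e).1 = v <;> by_cases h2 : (E e).2 = v <;> simp [h1, h2]
  exact absurd (h1.trans h2.symm) this

theorem graph_TD {n : ℕ} (T : SimpleGraph (Fin n)) (hT : T.IsTree)
    (E : Fin (n - 1) → Fin n × Fin n)
    (hE : ∀ i, T.Adj (E i).1 (E i).2)
    (hinj : Function.Injective fun i => (s((E i).1, (E i).2) : Sym2 (Fin n)))
    (hsurj : ∀ e ∈ T.edgeSet, ∃ i, e = s((E i).1, (E i).2)) :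
    TD (fun e => (E e).1) (fun e => (E e).2) (sideS T E) (fun v => 2 - (degr T v : ℝ)) where
  sq := sideS_sq T E
  Sa e := by simp [sideS, sideI]
  Sb e := by
    have h := (SimpleGraph.isAcyclic_iff_forall_adj_isBridge.mp hT.isAcyclic) (hE e)
    rw [SimpleGraph.isBridge_iff] at h
    simp only [sideS, sideI, h, if_false]
    norm_num
  ne e f hef := sideS_adj T E e _ _ (hE f) fun h => hef (hinj h).symm
  conn x hx u v := by
    obtain ⟨p⟩ := hT.isConnected.preconnected u v
    induction p with
    | nil => rfl
    | @cons u v _ h p ih =>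
      rw [← ih]
      obtain ⟨i, hi⟩ := hsurj s(u, v) h
      have := hx i
      rcases Sym2.eq_iff.mp hi with ⟨h1, h2⟩ | ⟨h1, h2⟩
      · rw [h1, h2]; exact this
      · rw [h1, h2]; exact this.symm
  deg v := by rw [degr_eq T E hE hinj hsurj v]

theorem path_sum {n : ℕ} (T : SimpleGraph (Fin n)) (hT : T.IsTree)
    (E : Fin (n - 1) → Fin n × Fin n) (w : Fin (n - 1) → ℝ)
    (hE : ∀ i, T.Adj (E i).1 (E i).2)
    (hinj : Function.Injective fun i => (s((E i).1, (E i).2) : Sym2 (Fin n)))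
    (hsurj : ∀ e ∈ T.edgeSet, ∃ i, e = s((E i).1, (E i).2))
    {u v : Fin n} (p : T.Walk u v) (hp : p.IsPath) :
    (p.edges.map (fun s => ∑ i : Fin (n-1), if s = s((E i).1, (E i).2) then w i else 0)).sum
      = dd w (sideS T E) u v := by
  have td := graph_TD T hT E hE hinj hsurj
  induction p with
  | nil => simp [td.dself w]
  | @cons u x v h p ih =>
    rw [SimpleGraph.Walk.cons_isPath_iff] at hp
    rw [SimpleGraph.Walk.edges_cons, List.map_cons, List.sum_cons, ih hp.1]
    unfold dd
    rw [← Finset.sum_add_distrib]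
    refine Finset.sum_congr rfl fun e _ => ?_
    by_cases he : s(u, x) = s((E e).1, (E e).2)
    · have h1 : s((E e).1, (E e).2) ∉ p.edges := by
        rw [← he]
        intro hh
        exact hp.2 (p.fst_mem_support_of_mem_edges hh)
      have h2 := sideS_walk T E e p h1
      have h3 : sideS T E e u = - sideS T E e x := by
        have ha := td.Sa e
        have hb := td.Sb e
        rcases Sym2.eq_iff.mp he with ⟨h1, h2⟩ | ⟨h1, h2⟩
        · rw [h1, h2, ha, hb]; norm_num
        · rw [h1, h2, ha, hb]
      rw [if_pos he, h3, h2]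
      linear_combination (-w e) * td.sq e v
    · rw [if_neg he, sideS_adj T E e u x h he]; ring

end graphpart

theorem stmt10 {n : ℕ} (T : SimpleGraph (Fin n)) (hT : T.IsTree)
    (E : Fin (n - 1) → Fin n × Fin n) (w : Fin (n - 1) → ℝ)
    (hw : ∀ i, w i ≠ 0)
    (hE : ∀ i, T.Adj (E i).1 (E i).2)
    (hinj : Function.Injective fun i => (s((E i).1, (E i).2) : Sym2 (Fin n)))
    (hsurj : ∀ e ∈ T.edgeSet, ∃ i, e = s((E i).1, (E i).2))
    (hdeg : ∀ v, degr T v ≠ 2) :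
    (sqDistMat T hT.isConnected E w).det
      = (-1 : ℝ) ^ (n - 1) * ((4 : ℝ) ^ ((n : ℤ) - 2) / 2)
        * (∏ v, (2 - (degr T v : ℝ))) * (∏ i, (w i) ^ 2)
        * (∑ v, (wdeg E w v) ^ 2 / (2 - (degr T v : ℝ))) := by
  have hcard : Fintype.card (Fin n) = Fintype.card (Fin (n - 1)) + 1 := by
    have : Nonempty (Fin n) := hT.isConnected.nonempty
    have := Fin.pos_iff_nonempty.mpr this
    simp; omega
  obtain ⟨r⟩ : Nonempty (Fin n) := hT.isConnected.nonempty
  have σ : Fin n ≃ Fin (n - 1) ⊕ Unit := Fintype.equivOfCardEq (by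
    rw [hcard]; simp)
  have td := graph_TD T hT E hE hinj hsurj
  have hτ : ∀ v, (2 - (degr T v : ℝ)) ≠ 0 := by
    intro v hv
    apply hdeg v
    have : (degr T v : ℝ) = 2 := by linarith
    exact_mod_cast this
  have key := td.main σ hcard hτ (sideI T E) (fun e v => rfl) r w
  have h1 : sqDistMat T hT.isConnected E w
      = Matrix.of fun u v => dd w (sideS T E) u v ^ 2 := by
    ext u v
    simp only [sqDistMat, wdist, Matrix.of_apply]
    rw [path_sum T hT E w hE hinj hsurj _ (SimpleGraph.Path.isPath _)]
  rw [h1, key]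
  simp_rw [wdeg_eq T E w hE]
  simp only [Fintype.card_fin] at hcard ⊢
  have h2 : ((n : ℤ) - 2) = ((n - 1 : ℕ) : ℤ) - 1 := by omega
  rw [h2, zpow_sub₀ (by norm_num), zpow_natCast, zpow_one]
  have h3 : (4 : ℝ) ^ (n - 1) = 2 ^ (n - 1) * 2 ^ (n - 1) := by
    rw [← mul_pow]; norm_num
  have h4 : (-2 : ℝ) ^ (n - 1) = (-1) ^ (n - 1) * 2 ^ (n - 1) := by
    rw [← mul_pow]; norm_num
  rw [h3, h4]
  ring

end
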